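/- (Conjugacy of spike-and-slab Pólya trees, Theorem 1.) Let L ≥ 1, let π_{ε0} ∈ (0,1] and α_ε > 0 for all binary strings ε with |ε| ≤ L, and let Q be the product probability measure on [0,1]^{E_L} (E_L the set of strings of length < L) under which the coordinates Y_{ε0} are independent with law (1-π_{ε0})δ_{1/2} + π_{ε0}Beta(α_{ε0},α_{ε1}). For X ∈ (0,1]^n let ℓ_X(Y) = ∏_{i=1}^n f_Y(X_i) be the likelihood. Then ∫ ℓ_X dQ = ∏_{ε:|ε|<L} ((1-π_{ε0}) + π_{ε0} T(ε,X)) > 0, and the probability measure whose density with respect to Q is ℓ_X / ∫ℓ_X dQ is the product measure under which the Y_{ε0}, |ε| < L, are independent with law (1-π̃_{ε0})δ_{1/2} + π̃_{ε0}Beta(α_{ε0}(X), α_{ε1}(X)). -/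

import Mathlib

open MeasureTheory Filter

noncomputable section

namespace SSPT

/-- Index set of the free tree coordinates: a node at depth `l < L` with position `k < 2^l`.
The coordinate at node `(l,k)` is the variable `Y_{ε0}` for the binary string `ε ≡ (l,k)`. -/
abbrev Node (L : ℕ) := (l : Fin L) × Fin (2 ^ (l : ℕ))

/-- Dyadic interval `I_{l,k} = (k 2^{-l}, (k+1) 2^{-l}]`. -/
def dyadic (l k : ℕ) : Set ℝ := Set.Ioc ((k : ℝ) / 2 ^ l) (((k : ℝ) + 1) / 2 ^ l)

/-- Number of sample points falling in a set. -/
def cnt {n : ℕ} (X : Fin n → ℝ) (s : Set ℝ) : ℕ := Nat.card {i : Fin n // X i ∈ s}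

/-- `N_X(I_{l,k})`. -/
def Ncnt {n : ℕ} (X : Fin n → ℝ) (l k : ℕ) : ℕ := cnt X (dyadic l k)

/-- `L = L(n)`: the largest integer with `2^L L² ≤ n`. -/
def Ln (n : ℕ) : ℕ := Nat.findGreatest (fun L => 2 ^ L * L ^ 2 ≤ n) n

/-- The tree variable `Y_{(l,k)}` (depth `1 ≤ l ≤ L`) built from the free coordinates
`y : Node L → ℝ`:  `Y_{ε0} = y(ε)` and `Y_{ε1} = 1 - y(ε)`.  Junk value `1/2` otherwise. -/
def Yt (L : ℕ) (y : Node L → ℝ) (l k : ℕ) : ℝ :=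
  if h : 0 < l ∧ l ≤ L ∧ k < 2 ^ l then
    have h1 : l - 1 < L := by omega
    have h2 : k / 2 < 2 ^ (l - 1) := by
      have hl : l - 1 + 1 = l := by omega
      have hk : k < 2 ^ (l - 1) * 2 := by rw [← pow_succ, hl]; exact h.2.2
      omega
    if k % 2 = 0 then y ⟨⟨l - 1, h1⟩, ⟨k / 2, h2⟩⟩ else 1 - y ⟨⟨l - 1, h1⟩, ⟨k / 2, h2⟩⟩
  else 1 / 2

/-- `P(I_ε) = ∏_{j=1}^{l} Y_{ε_1…ε_j}` for `ε ≡ (l,k)`. -/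
def Pmass (L : ℕ) (y : Node L → ℝ) : ℕ → ℕ → ℝ
  | 0, _ => 1
  | l + 1, k => Pmass L y l (k / 2) * Yt L y (l + 1) k

/-- The histogram density `f_Y = Σ_{|ε|=L} 2^L P(I_ε) 1_{I_ε}` associated with the tree. -/
def fY (L : ℕ) (y : Node L → ℝ) (x : ℝ) : ℝ :=
  ∑ k ∈ Finset.range (2 ^ L), (2 ^ L * Pmass L y L k) * (dyadic L k).indicator 1 x

/-- The Haar mother wavelet `ψ = -1 on (0,1/2], +1 on (1/2,1]`. -/
def haarMother (x : ℝ) : ℝ :=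
  (Set.Ioc (1 / 2 : ℝ) 1).indicator 1 x - (Set.Ioc (0 : ℝ) (1 / 2)).indicator 1 x

/-- `ψ_{lk}(x) = 2^{l/2} ψ(2^l x - k)`. -/
def psi (l k : ℕ) (x : ℝ) : ℝ := 2 ^ ((l : ℝ) / 2) * haarMother (2 ^ l * x - k)

/-- Haar coefficient `f_{lk} = ⟨f, ψ_{lk}⟩`. -/
def haarCoef (f : ℝ → ℝ) (l k : ℕ) : ℝ := ∫ x in Set.Ioc (0 : ℝ) 1, f x * psi l k x

/-- Hölder-type ball `H(α,R)`. -/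
def holder (α R : ℝ) (f : ℝ → ℝ) : Prop :=
  ∀ l k : ℕ, k < 2 ^ l → |haarCoef f l k| ≤ R * 2 ^ (-(l : ℝ) * (α + 1 / 2))

/-- The class `F(m0,m1)` of densities on `(0,1]` bounded below and above. -/
def densClass (m0 m1 : ℝ) (f : ℝ → ℝ) : Prop :=
  Measurable f ∧ (∫ x in Set.Ioc (0 : ℝ) 1, f x) = 1 ∧
    ∀ x ∈ Set.Ioc (0 : ℝ) 1, m0 ≤ f x ∧ f x ≤ m1

/-- The measure `P_f` with density `f` on `(0,1]`. -/
def Pf (f : ℝ → ℝ) : Measure ℝ :=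
  (volume.restrict (Set.Ioc (0 : ℝ) 1)).withDensity fun x => ENNReal.ofReal (f x)

/-- Law of an i.i.d. `n`-sample from `P_f`. -/
def Pn (n : ℕ) (f : ℝ → ℝ) : Measure (Fin n → ℝ) := Measure.pi fun _ => Pf f

/-- Beta function `B(a,b)`. -/
def betaFn (a b : ℝ) : ℝ := Real.Gamma a * Real.Gamma b / Real.Gamma (a + b)

/-- The `Beta(a,b)` distribution on `(0,1]`. -/
def betaMeasure (a b : ℝ) : Measure ℝ :=
  (volume.restrict (Set.Ioc (0 : ℝ) 1)).withDensity fun x =>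
    ENNReal.ofReal (x ^ (a - 1) * (1 - x) ^ (b - 1) / betaFn a b)

/-- Spike and slab mixture `(1-p) δ_{1/2} + p μ`. -/
def mix (p : ℝ) (μ : Measure ℝ) : Measure ℝ :=
  ENNReal.ofReal (1 - p) • Measure.dirac (1 / 2 : ℝ) + ENNReal.ofReal p • μ

/-- The spike-and-slab Pólya tree prior with slab `Beta(a,a)` and slab weights
`π j` at depth `j` (the coordinate at node `(l,k)` is `Y_{ε0}` with `|ε0| = l+1`). -/
def ssPrior (L : ℕ) (a : ℝ) (π : ℕ → ℝ) : Measure (Node L → ℝ) :=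
  Measure.pi fun p => mix (π ((p.1 : ℕ) + 1)) (betaMeasure a a)

/-- Likelihood of the sample under the histogram density `f_Y`. -/
def lik {n : ℕ} (L : ℕ) (X : Fin n → ℝ) (y : Node L → ℝ) : ℝ := ∏ i, fY L y (X i)

/-- The posterior distribution `Π(· | X)` of the tree coordinates, obtained from the
prior via Bayes' formula. -/
def post {n : ℕ} (L : ℕ) (a : ℝ) (π : ℕ → ℝ) (X : Fin n → ℝ) : Measure (Node L → ℝ) :=
  ((((ssPrior L a π).withDensity fun y => ENNReal.ofReal (lik L X y)) Set.univ)⁻¹) •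
    ((ssPrior L a π).withDensity fun y => ENNReal.ofReal (lik L X y))

/-- `T(ε,X) = 2^{N_X(I_ε)} B(N_X(I_{ε0})+a, N_X(I_{ε1})+a)/B(a,a)`. -/
def Tstat {n : ℕ} (a : ℝ) (X : Fin n → ℝ) (l k : ℕ) : ℝ :=
  2 ^ Ncnt X l k *
    betaFn ((Ncnt X (l + 1) (2 * k) : ℝ) + a) ((Ncnt X (l + 1) (2 * k + 1) : ℝ) + a) / betaFn a a

/-- Posterior slab weight `π̃_{ε0}`. -/
def piT {n : ℕ} (a : ℝ) (π : ℕ → ℝ) (X : Fin n → ℝ) (l k : ℕ) : ℝ :=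
  π (l + 1) * Tstat a X l k / ((1 - π (l + 1)) + π (l + 1) * Tstat a X l k)

/-- The (explicit, conjugate) marginal posterior distribution of `Y_{ε0}` for `ε ≡ (l,k)`:
`(1-π̃_{ε0}) δ_{1/2} + π̃_{ε0} Beta(N_X(I_{ε0})+a, N_X(I_{ε1})+a)`. -/
def margPost {n : ℕ} (a : ℝ) (π : ℕ → ℝ) (X : Fin n → ℝ) (l k : ℕ) : Measure ℝ :=
  mix (piT a π X l k)
    (betaMeasure ((Ncnt X (l + 1) (2 * k) : ℝ) + a) ((Ncnt X (l + 1) (2 * k + 1) : ℝ) + a))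

/-- The explicit (conjugate) posterior: product of the marginal posteriors. -/
def postExplicit {n : ℕ} (L : ℕ) (a : ℝ) (π : ℕ → ℝ) (X : Fin n → ℝ) :
    Measure (Node L → ℝ) :=
  Measure.pi fun p => margPost a π X (p.1 : ℕ) (p.2 : ℕ)

/-- `F_0(I_{l,k}) = ∫_{I_{l,k}} f_0`. -/
def F0 (f0 : ℝ → ℝ) (l k : ℕ) : ℝ := ∫ x in dyadic l k, f0 x

/-- `y_{ε0} = F_0(I_{ε0})/F_0(I_ε)` for `ε ≡ (l,k)`. -/
def yeps (f0 : ℝ → ℝ) (l k : ℕ) : ℝ := F0 f0 (l + 1) (2 * k) / F0 f0 l k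

/-- The event `B = B(M)`:  `|N_X(I^l_k) - n F_0(I^l_k)| ≤ M √((l+L)n/2^l)` for all `l ≤ L`, `k < 2^l`. -/
def eventB (n : ℕ) (M : ℝ) (f0 : ℝ → ℝ) : Set (Fin n → ℝ) :=
  {X | ∀ l ≤ Ln n, ∀ k < 2 ^ l,
    |(Ncnt X l k : ℝ) - n * F0 f0 l k| ≤
      M * Real.sqrt (((l : ℝ) + Ln n) * n / 2 ^ l)}

/-- The posterior mean `Ȳ_{ε0} = (1-π̃_{ε0})/2 + π̃_{ε0} (N_X(I_{ε0})+a)/(N_X(I_ε)+2a)`. -/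
def YbarNode {n : ℕ} (a : ℝ) (π : ℕ → ℝ) (X : Fin n → ℝ) (l k : ℕ) : ℝ :=
  (1 - piT a π X l k) * (1 / 2) +
    piT a π X l k * (((Ncnt X (l + 1) (2 * k) : ℝ) + a) / ((Ncnt X l k : ℝ) + 2 * a))

/-- Given a node function `Y : (l,k) ↦ Y_{ε0}`, the value of the tree variable at
depth `l ≥ 1` and position `k`: `Y_{ε0}` for even `k`, `1 - Y_{ε0}` for odd `k`. -/
def childT (Ynode : ℕ → ℕ → ℝ) (l k : ℕ) : ℝ :=
  if l = 0 then 1 / 2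
  else if k % 2 = 0 then Ynode (l - 1) (k / 2) else 1 - Ynode (l - 1) (k / 2)

/-- Product of the tree variables along the path to node `(l,k)`. -/
def pathProd (Ynode : ℕ → ℕ → ℝ) : ℕ → ℕ → ℝ
  | 0, _ => 1
  | l + 1, k => pathProd Ynode l (k / 2) * childT Ynode (l + 1) k

/-- Haar coefficient induced by a tree: `2^{l/2} p_ε (1 - 2 Y_{ε0})`. -/
def coefOfNodes (Ynode : ℕ → ℕ → ℝ) (l k : ℕ) : ℝ :=
  2 ^ ((l : ℝ) / 2) * pathProd Ynode l k * (1 - 2 * Ynode l k)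

/-- `p̄_ε`: mass of `I_ε` under the posterior mean. -/
def pbar {n : ℕ} (a : ℝ) (π : ℕ → ℝ) (X : Fin n → ℝ) (l k : ℕ) : ℝ :=
  pathProd (YbarNode a π X) l k

/-- The cut-off `𝓛 = 𝓛_n(α)` with `2^𝓛 = ⌊c₀ (n/log n)^{1/(1+2α)}⌋`. -/
def calL (c0 α : ℝ) (n : ℕ) : ℕ :=
  Nat.log 2 ⌊c0 * ((n : ℝ) / Real.log n) ^ (1 / (1 + 2 * α))⌋₊

/-- The minimax sup-norm rate `ε*_{n,α} = (log n/n)^{α/(2α+1)}`. -/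
def rateSup (α : ℝ) (n : ℕ) : ℝ := (Real.log n / n) ^ (α / (2 * α + 1))

/-- Supremum distance on `(0,1]`. -/
def supDist (f g : ℝ → ℝ) : ℝ := ⨆ x : Set.Ioc (0 : ℝ) 1, |f x.1 - g x.1|

/-- Multiscale norm `‖x‖_{M₀(w)} = sup_l max_{k<2^l} |x_{lk}|/w_l`. -/
def M0norm (w : ℕ → ℝ) (x : ℕ → ℕ → ℝ) : ℝ :=
  ⨆ l : ℕ, ⨆ k : Fin (2 ^ l), |x l (k : ℕ)| / w l

/-- Distance associated with the multiscale norm. -/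
def M0dist (w : ℕ → ℝ) (x y : ℕ → ℕ → ℝ) : ℝ := M0norm w fun l k => x l k - y l k

/-- Haar coefficients of the centering `C_n`:
empirical coefficients for `l ≤ L`, and `0` for `l > L`. -/
def CnArr {n : ℕ} (X : Fin n → ℝ) (l k : ℕ) : ℝ :=
  if l ≤ Ln n then (∑ i, psi l k (X i)) / n else 0

/-- Prior slab weights of Theorem 2: `π_l = e^{-κl}/Σ_{j=0}^{L} e^{-κj}`. -/
def priorW (κ : ℝ) (L : ℕ) (j : ℕ) : ℝ :=
  Real.exp (-κ * j) / ∑ i ∈ Finset.range (L + 1), Real.exp (-κ * i)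

/-- Unnormalized prior slab weights `π_l = e^{-κl}`. -/
def expW (κ : ℝ) (j : ℕ) : ℝ := Real.exp (-κ * j)

/-- Flat-initialisation slab weights: weight `1` (pure Beta) for nodes `ε` with `|ε| ≤ l₀`,
i.e. child depth `j = |ε|+1 ≤ l₀+1`, and `e^{-κ j}` beyond. -/
def flatW (κ : ℝ) (l0 : ℕ) (j : ℕ) : ℝ :=
  if j ≤ l0 + 1 then 1 else Real.exp (-κ * j)

/-- Median of a measure on `ℝ`. -/
def med (μ : Measure ℝ) : ℝ := sInf {t : ℝ | (1 / 2 : ENNReal) ≤ μ (Set.Iic t)}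

/-- The exponent `H(β,l)`: `β` for `l ≤ dL`, `α₀` for `l > dL`, `d = 1/α₀`. -/
def Hfun (α0 : ℝ) (L : ℕ) (β : ℝ) (l : ℕ) : ℝ := if (l : ℝ) ≤ (L : ℝ) / α0 then β else α0

/-- The norm `‖g‖_{β,L} = sup_l max_k 2^{l(H(β,l)+1/2)} |g_{lk}|`. -/
def normBL (α0 : ℝ) (L : ℕ) (β : ℝ) (g : ℕ → ℕ → ℝ) : ℝ :=
  ⨆ l : ℕ, ⨆ k : Fin (2 ^ l), 2 ^ ((l : ℝ) * (Hfun α0 L β l + 1 / 2)) * |g l (k : ℕ)|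

/-- Haar projection `K_j(f) = Σ_{l ≤ j-1} Σ_k ⟨f,ψ_{lk}⟩ ψ_{lk}`. -/
def Kproj (f : ℝ → ℝ) (j : ℕ) (t : ℝ) : ℝ :=
  ∑ l ∈ Finset.range j, ∑ k ∈ Finset.range (2 ^ l), haarCoef f l k * psi l k t

/-- Self-similar Hölder class `H_SS(α,M,ε)` (with base level `j₀`). -/
def selfSimilar (α Mc ε : ℝ) (j0 : ℕ) (f : ℝ → ℝ) : Prop :=
  holder α Mc f ∧ ∀ j : ℕ, j0 ≤ j → ε * 2 ^ (-(j : ℝ) * α) ≤ supDist (Kproj f j) f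

/-- Function reconstructed from an array of Haar coefficients. -/
def reconstruct (g : ℕ → ℕ → ℝ) (t : ℝ) : ℝ :=
  ∑' l : ℕ, ∑ k ∈ Finset.range (2 ^ l), g l k * psi l k t

/-- Bounded-Lipschitz distance between two measures, relative to a distance function `d`. -/
def BLdist {S : Type*} [MeasurableSpace S] (d : S → S → ℝ) (μ ν : Measure S) : ℝ :=
  ⨆ F : {F : S → ℝ // Measurable F ∧ ∃ c1 c2 : ℝ, 0 ≤ c1 ∧ 0 ≤ c2 ∧ c1 + c2 ≤ 1 ∧
      (∀ x, |F x| ≤ c1) ∧ ∀ x y, |F x - F y| ≤ c2 * d x y},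
    |(∫ x, F.1 x ∂μ) - ∫ x, F.1 x ∂ν|

/-- The recentering map `τ_{C_n} : f ↦ √n (f - C_n)` at the level of Haar coefficient arrays,
applied to a posterior draw of tree coordinates. -/
def tauMap {n : ℕ} (L : ℕ) (X : Fin n → ℝ) (y : Node L → ℝ) : ℕ → ℕ → ℝ :=
  fun l k => Real.sqrt n * (haarCoef (fY L y) l k - CnArr X l k)

/-- `∫ ψ_{lk} f₀`. -/
def psiMean (f0 : ℝ → ℝ) (l k : ℕ) : ℝ := ∫ t in Set.Ioc (0 : ℝ) 1, psi l k t * f0 t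

/-- Covariance of the `P_{f0}`-white bridge coordinates. -/
def covWB (f0 : ℝ → ℝ) (p q : ℕ × ℕ) : ℝ :=
  ∫ t in Set.Ioc (0 : ℝ) 1,
    (psi p.1 p.2 t - psiMean f0 p.1 p.2) * (psi q.1 q.2 t - psiMean f0 q.1 q.2) * f0 t

/-- `N` is a law of the `P_{f0}`-white bridge coordinate process: a probability measure
whose finite-dimensional linear marginals are centered Gaussian with the prescribed
covariance. -/
def isWhiteBridge (f0 : ℝ → ℝ) (N : Measure (ℕ → ℕ → ℝ)) : Prop :=
  IsProbabilityMeasure N ∧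
    ∀ c : (ℕ × ℕ) →₀ ℝ,
      N.map (fun x => ∑ p ∈ c.support, c p * x p.1 p.2) =
        ProbabilityTheory.gaussianReal 0
          (Real.toNNReal (∑ p ∈ c.support, ∑ q ∈ c.support, c p * c q * covWB f0 p q))

/-- The coordinate-wise marginal of the posterior at node `(l,k)`, `l < L`. -/
def postMarg {n : ℕ} (L : ℕ) (a : ℝ) (π : ℕ → ℝ) (X : Fin n → ℝ) (l k : ℕ) : Measure ℝ :=
  if h : l < L ∧ k < 2 ^ l then
    (post L a π X).map fun y => y ⟨⟨l, h.1⟩, ⟨k, h.2⟩⟩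
  else Measure.dirac (1 / 2 : ℝ)

/-- `ŷ_{ε0}`: the median of the marginal posterior of `Y_{ε0}` (`1/2` for `|ε| ≥ L`). -/
def yhatNode {n : ℕ} (L : ℕ) (a : ℝ) (π : ℕ → ℝ) (X : Fin n → ℝ) (l k : ℕ) : ℝ :=
  if l < L then med (postMarg L a π X l k) else 1 / 2

/-- The coefficients `f̂_{lk}` of the median-based pivot density estimator. -/
def fhat {n : ℕ} (L : ℕ) (a : ℝ) (π : ℕ → ℝ) (X : Fin n → ℝ) (l k : ℕ) : ℝ :=
  if l ≤ L then coefOfNodes (yhatNode L a π X) l k else 0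

/-- `ŷ_{ε0}` built from the explicit conjugate marginal posterior. -/
def yhatNodeE {n : ℕ} (L : ℕ) (a : ℝ) (π : ℕ → ℝ) (X : Fin n → ℝ) (l k : ℕ) : ℝ :=
  if l < L then med (margPost a π X l k) else 1 / 2

/-- Pivot coefficients built from the explicit conjugate marginal posterior medians. -/
def fhatE {n : ℕ} (L : ℕ) (a : ℝ) (π : ℕ → ℝ) (X : Fin n → ℝ) (l k : ℕ) : ℝ :=
  if l ≤ L then coefOfNodes (yhatNodeE L a π X) l k else 0

/-- `L̂`: the largest level carrying a nonzero coefficient of `f̂`. -/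
def Lhat (f : ℕ → ℕ → ℝ) : ℕ := sSup {l : ℕ | ∃ k < 2 ^ l, f l k ≠ 0}

/-- `α̂ = (1/2)[(1/L̂) log₂(n/log n) - 1]`. -/
def alphaHat (n Lh : ℕ) : ℝ :=
  (1 / 2) * ((1 / (Lh : ℝ)) * Real.logb 2 ((n : ℝ) / Real.log n) - 1)

/-- The quantile radius `R_n`: generalized `(1-γ)`-quantile of `√n ‖f - C_n‖_{M₀(w)}`
under the posterior. -/
def Rquant {n : ℕ} (L : ℕ) (a : ℝ) (π : ℕ → ℝ) (X : Fin n → ℝ) (w : ℕ → ℝ) (γ : ℝ) : ℝ :=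
  sInf {r : ℝ | ENNReal.ofReal (1 - γ) ≤
    post L a π X
      {y | Real.sqrt n *
        M0norm w (fun l k => haarCoef (fY L y) l k - CnArr X l k) ≤ r}}

/-- `l₀(n) = log n / log log n`. -/
def l0cred (n : ℕ) : ℕ := ⌊Real.log n / Real.log (Real.log n)⌋₊

/-- `w_l = √l log l`. -/
def wcred (l : ℕ) : ℝ := Real.sqrt l * Real.log l

/-- The credible band `C`, as a set of Haar-coefficient arrays. -/
def credSet {n : ℕ} (a : ℝ) (π : ℕ → ℝ) (X : Fin n → ℝ) (α0 γ un : ℝ) :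
    Set (ℕ → ℕ → ℝ) :=
  {g | M0norm wcred (fun l k => g l k - CnArr X l k) ≤
        Rquant (Ln n) a π X wcred γ / Real.sqrt n ∧
      normBL α0 (Ln n) (alphaHat n (Lhat (fhat (Ln n) a π X))) g ≤ un}

/-- Spike and slab Pólya tree prior with general node-wise Beta parameters `A` and
slab weights `πw` (the coordinate at node `(l,k)`, `l < L`, is `Y_{ε0}` with slab
`Beta(α_{ε0}, α_{ε1})`). -/
def ssPriorGen (L : ℕ) (A : ℕ → ℕ → ℝ) (πw : ℕ → ℕ → ℝ) : Measure (Node L → ℝ) :=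
  Measure.pi fun p =>
    mix (πw (p.1 : ℕ) (p.2 : ℕ))
      (betaMeasure (A ((p.1 : ℕ) + 1) (2 * (p.2 : ℕ)))
        (A ((p.1 : ℕ) + 1) (2 * (p.2 : ℕ) + 1)))

/-- `T(ε,X) = 2^{N_X(I_ε)} B(N_X(I_{ε0})+α_{ε0}, N_X(I_{ε1})+α_{ε1}) / B(α_{ε0},α_{ε1})`. -/
def TstatGen {n : ℕ} (A : ℕ → ℕ → ℝ) (X : Fin n → ℝ) (l k : ℕ) : ℝ :=
  2 ^ Ncnt X l k *
    betaFn ((Ncnt X (l + 1) (2 * k) : ℝ) + A (l + 1) (2 * k))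
      ((Ncnt X (l + 1) (2 * k + 1) : ℝ) + A (l + 1) (2 * k + 1)) /
    betaFn (A (l + 1) (2 * k)) (A (l + 1) (2 * k + 1))

/-- Posterior slab weight `π̃_{ε0} = π_{ε0} T(ε,X)/((1-π_{ε0}) + π_{ε0} T(ε,X))`. -/
def piTGen {n : ℕ} (A : ℕ → ℕ → ℝ) (πw : ℕ → ℕ → ℝ) (X : Fin n → ℝ) (l k : ℕ) : ℝ :=
  πw l k * TstatGen A X l k / ((1 - πw l k) + πw l k * TstatGen A X l k)

lemma pi_wd {ι : Type*} [Fintype ι] (μ ν : ι → Measure ℝ) [∀ i, IsProbabilityMeasure (μ i)]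
    [∀ i, SigmaFinite (ν i)] (h : ι → ℝ → ENNReal) (hm : ∀ i, Measurable (h i))
    (hν : ∀ i, (μ i).withDensity (h i) = ν i) :
    (Measure.pi μ).withDensity (fun y => ∏ i, h i (y i)) = Measure.pi ν := by
  symm
  apply Measure.pi_eq
  intro s hs
  have hS : MeasurableSet (Set.pi Set.univ s) := MeasurableSet.univ_pi hs
  rw [withDensity_apply _ hS, ← lintegral_indicator hS]
  have h1 : (Set.pi Set.univ s).indicator (fun y => ∏ i, h i (y i))
      = fun y => ∏ i, (s i).indicator (h i) (y i) := by
    funext y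
    by_cases hy : y ∈ Set.pi Set.univ s
    · rw [Set.indicator_of_mem hy]
      refine Finset.prod_congr rfl fun i _ => ?_
      rw [Set.indicator_of_mem (hy i (Set.mem_univ i))]
    · rw [Set.indicator_of_notMem hy]
      have : ∃ i, y i ∉ s i := by
        by_contra hc
        push Not at hc
        exact hy fun i _ => hc i
      obtain ⟨i, hi⟩ := this
      exact (Finset.prod_eq_zero (Finset.mem_univ i) (Set.indicator_of_notMem hi _)).symm
  have hmi : ∀ i, Measurable ((s i).indicator (h i)) := fun i => (hm i).indicator (hs i)
  rw [h1, ProbabilityTheory.lintegral_prod_eq_prod_lintegral_of_indepFun Finset.univ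
    (fun i (y : ι → ℝ) => (s i).indicator (h i) (y i))
    (ProbabilityTheory.iIndepFun_pi fun i => (hmi i).aemeasurable)
    (fun i => (hmi i).comp (measurable_pi_apply i))]
  refine Finset.prod_congr rfl fun i _ => ?_
  rw [(measurePreserving_eval μ i).lintegral_comp (hmi i), lintegral_indicator (hs i),
    ← withDensity_apply _ (hs i), hν]

lemma betaFn_pos {a b : ℝ} (ha : 0 < a) (hb : 0 < b) : 0 < betaFn a b :=
  div_pos (mul_pos (Real.Gamma_pos_of_pos ha) (Real.Gamma_pos_of_pos hb))
    (Real.Gamma_pos_of_pos (add_pos ha hb))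

lemma betaMeasure_eq (a b : ℝ) : betaMeasure a b = ProbabilityTheory.betaMeasure a b := by
  unfold betaMeasure ProbabilityTheory.betaMeasure
  rw [← restrict_Ioo_eq_restrict_Ioc, ← withDensity_indicator measurableSet_Ioo]
  congr 1
  funext x
  by_cases hx : x ∈ Set.Ioo (0 : ℝ) 1
  · rw [Set.indicator_of_mem hx, ProbabilityTheory.betaPDF_of_pos_lt_one hx.1 hx.2]
    congr 1
    unfold betaFn ProbabilityTheory.beta
    ring
  · rw [Set.indicator_of_notMem hx, ProbabilityTheory.betaPDF_eq, if_neg (by simpa using hx)]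
    simp

lemma betaMeasure_prob {a b : ℝ} (ha : 0 < a) (hb : 0 < b) :
    IsProbabilityMeasure (betaMeasure a b) := by
  rw [betaMeasure_eq]
  exact ProbabilityTheory.isProbabilityMeasureBeta ha hb

lemma mix_prob {p : ℝ} (h0 : 0 ≤ p) (h1 : p ≤ 1) (μ : Measure ℝ) [IsProbabilityMeasure μ] :
    IsProbabilityMeasure (mix p μ) := by
  constructor
  unfold mix
  simp only [Measure.coe_add, Measure.coe_smul, Pi.add_apply, Pi.smul_apply, measure_univ,
    smul_eq_mul, mul_one]
  rw [← ENNReal.ofReal_add (by linarith) h0]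
  simp

lemma beta_wd {a b : ℝ} (ha : 0 < a) (hb : 0 < b) (m k : ℕ) {c : ℝ} (hc : 0 ≤ c) :
    (betaMeasure a b).withDensity (fun x => ENNReal.ofReal (c * (x ^ m * (1 - x) ^ k))) =
      ENNReal.ofReal (c * (betaFn (m + a) (k + b) / betaFn a b)) •
        betaMeasure (m + a) (k + b) := by
  have hB := betaFn_pos ha hb
  have hB' := betaFn_pos (a := m + a) (b := k + b) (by positivity) (by positivity)
  unfold betaMeasure
  rw [← withDensity_mul _ (by fun_prop) (by fun_prop), ← withDensity_smul _ (by fun_prop),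
    ← restrict_Ioo_eq_restrict_Ioc]
  apply withDensity_congr_ae
  filter_upwards [ae_restrict_mem measurableSet_Ioo] with x hx
  have hx0 : 0 < x := hx.1
  have hx1 : 0 < 1 - x := by linarith [hx.2]
  simp only [Pi.mul_apply, Pi.smul_apply, smul_eq_mul]
  rw [← ENNReal.ofReal_mul (by positivity), ← ENNReal.ofReal_mul (by positivity)]
  congr 1
  rw [show (m : ℝ) + a - 1 = m + (a - 1) by ring, show (k : ℝ) + b - 1 = k + (b - 1) by ring,
    Real.rpow_add hx0, Real.rpow_add hx1, Real.rpow_natCast, Real.rpow_natCast]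
  field_simp

lemma mix_wd {a b p T Z : ℝ} (ha : 0 < a) (hb : 0 < b) (hp : 0 < p) (hp1 : p ≤ 1) (m k N : ℕ)
    (hN : N = m + k) (hT : T = 2 ^ N * betaFn (m + a) (k + b) / betaFn a b)
    (hZ : Z = (1 - p) + p * T) :
    (mix p (betaMeasure a b)).withDensity
      (fun x => ENNReal.ofReal (2 ^ N * (x ^ m * (1 - x) ^ k) / Z)) =
    mix (p * T / Z) (betaMeasure (m + a) (k + b)) := by
  have hB := betaFn_pos ha hb
  have hB' := betaFn_pos (a := m + a) (b := k + b) (by positivity) (by positivity)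
  have hTp : 0 < T := by rw [hT]; positivity
  have hZp : 0 < Z := by
    have := mul_pos hp hTp
    linarith
  unfold mix
  rw [withDensity_add_measure, withDensity_smul_measure, withDensity_smul_measure,
    dirac_withDensity]
  have e : (fun x : ℝ => ENNReal.ofReal (2 ^ N * (x ^ m * (1 - x) ^ k) / Z)) =
    fun x : ℝ => ENNReal.ofReal (2 ^ N / Z * (x ^ m * (1 - x) ^ k)) := by
    funext x; congr 1; ring
  rw [e, beta_wd ha hb m k (by positivity), smul_smul, smul_smul,
    ← ENNReal.ofReal_mul (by linarith), ← ENNReal.ofReal_mul hp.le]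
  congr 3
  · have : (2 : ℝ) ^ N * ((1 / 2) ^ m * (1 - 1 / 2) ^ k) = 1 := by
      rw [hN, show (1 - 1 / 2 : ℝ) = 1 / 2 by norm_num, ← pow_add, ← mul_pow]
      norm_num
    rw [this, hZ]
    rw [hZ] at hZp
    field_simp
    ring
  · rw [hT]
    ring

lemma mix_ae {a b p : ℝ} : ∀ᵐ x ∂(mix p (betaMeasure a b)), x ∈ Set.Icc (0 : ℝ) 1 := by
  unfold mix
  rw [ae_add_measure_iff]
  constructor
  · apply Measure.ae_smul_measure
    rw [ae_dirac_eq, Filter.eventually_pure]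
    norm_num
  · apply Measure.ae_smul_measure
    apply (withDensity_absolutelyContinuous _ _).ae_le
    filter_upwards [ae_restrict_mem measurableSet_Ioc] with x hx
    exact ⟨hx.1.le, hx.2⟩

/-- Index of the dyadic interval of level `l` containing `x`. -/
def kx (x : ℝ) (l : ℕ) : ℕ := ⌈2 ^ l * x⌉₊ - 1

lemma mem_dyadic_iff {x : ℝ} (hx : 0 < x) (l k : ℕ) : x ∈ dyadic l k ↔ kx x l = k := by
  have hpos : 0 < ⌈2 ^ l * x⌉₊ := Nat.ceil_pos.2 (by positivity)
  have h2 : (0 : ℝ) < 2 ^ l := by positivity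
  have h1 : kx x l = k ↔ ⌈2 ^ l * x⌉₊ = k + 1 := by unfold kx; omega
  rw [h1, Nat.ceil_eq_iff (by omega)]
  unfold dyadic
  rw [Set.mem_Ioc, div_lt_iff₀ h2, le_div_iff₀ h2]
  simp only [Nat.add_sub_cancel]
  push_cast
  rw [mul_comm x]

lemma kx_lt {x : ℝ} (hx : x ∈ Set.Ioc (0 : ℝ) 1) (l : ℕ) : kx x l < 2 ^ l := by
  have h : ⌈2 ^ l * x⌉₊ ≤ 2 ^ l := by
    apply Nat.ceil_le.2
    push_cast
    have h2 : (0 : ℝ) < 2 ^ l := by positivity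
    nlinarith [hx.2]
  have : 0 < 2 ^ l := by positivity
  unfold kx
  omega

lemma kx_half {x : ℝ} (hx : 0 < x) (l : ℕ) : kx x (l + 1) / 2 = kx x l := by
  symm
  rw [← mem_dyadic_iff hx]
  have h := (mem_dyadic_iff hx (l + 1) (kx x (l + 1))).2 rfl
  have h2 : (0 : ℝ) < 2 ^ l := by positivity
  unfold dyadic at h ⊢
  rw [Set.mem_Ioc, div_lt_iff₀ (by positivity), le_div_iff₀ (by positivity)] at h ⊢
  rw [pow_succ] at h
  obtain ⟨q, hq⟩ : ∃ q, kx x (l + 1) / 2 = q := ⟨_, rfl⟩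
  rw [hq]
  have hk : kx x (l + 1) = 2 * q ∨ kx x (l + 1) = 2 * q + 1 := by omega
  rcases hk with hk | hk <;> rw [hk] at h <;> push_cast at h <;>
    constructor <;> nlinarith [h.1, h.2]

lemma Ncnt_eq {n : ℕ} (X : Fin n → ℝ) (hX : ∀ i, X i ∈ Set.Ioc (0 : ℝ) 1) (l k : ℕ) :
    Ncnt X l k = ∑ i, if kx (X i) l = k then 1 else 0 := by
  unfold Ncnt cnt
  simp_rw [fun i => mem_dyadic_iff (hX i).1 l k]
  rw [Nat.card_eq_fintype_card, Fintype.card_subtype, Finset.card_filter]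

lemma Ncnt_add {n : ℕ} (X : Fin n → ℝ) (hX : ∀ i, X i ∈ Set.Ioc (0 : ℝ) 1) (l k : ℕ) :
    Ncnt X l k = Ncnt X (l + 1) (2 * k) + Ncnt X (l + 1) (2 * k + 1) := by
  rw [Ncnt_eq X hX, Ncnt_eq X hX, Ncnt_eq X hX, ← Finset.sum_add_distrib]
  refine Finset.sum_congr rfl fun i _ => ?_
  have := kx_half (hX i).1 l
  split_ifs <;> omega

lemma Yt_even (L : ℕ) (y : Node L → ℝ) (l k : ℕ) (hl : l < L) (hk : k < 2 ^ l) :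
    Yt L y (l + 1) (2 * k) = y ⟨⟨l, hl⟩, ⟨k, hk⟩⟩ := by
  have hk2 : 2 * k < 2 ^ (l + 1) := by rw [pow_succ]; omega
  unfold Yt
  rw [dif_pos ⟨by omega, by omega, hk2⟩]
  simp

lemma Yt_odd (L : ℕ) (y : Node L → ℝ) (l k : ℕ) (hl : l < L) (hk : k < 2 ^ l) :
    Yt L y (l + 1) (2 * k + 1) = 1 - y ⟨⟨l, hl⟩, ⟨k, hk⟩⟩ := by
  have hk2 : 2 * k + 1 < 2 ^ (l + 1) := by rw [pow_succ]; omega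
  have hd : (2 * k + 1) / 2 = k := by omega
  unfold Yt
  rw [dif_pos ⟨by omega, by omega, hk2⟩]
  simp [hd]

lemma Pmass_eq (L : ℕ) (y : Node L → ℝ) {x : ℝ} (hx : 0 < x) (l : ℕ) :
    2 ^ l * Pmass L y l (kx x l) = ∏ j ∈ Finset.range l, (2 * Yt L y (j + 1) (kx x (j + 1))) := by
  induction l with
  | zero => simp [Pmass]
  | succ l ih =>
    rw [Finset.prod_range_succ, ← ih, Pmass, kx_half hx]
    ring

lemma fY_eq (L : ℕ) (y : Node L → ℝ) {x : ℝ} (hx : x ∈ Set.Ioc (0 : ℝ) 1) :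
    fY L y x = ∏ p : Node L, (2 ^ (if kx x p.1 = p.2 then 1 else 0) *
      (y p ^ (if kx x ((p.1 : ℕ) + 1) = 2 * (p.2 : ℕ) then 1 else 0) *
        (1 - y p) ^ (if kx x ((p.1 : ℕ) + 1) = 2 * (p.2 : ℕ) + 1 then 1 else 0))) := by
  have h1 : fY L y x = 2 ^ L * Pmass L y L (kx x L) := by
    unfold fY
    rw [Finset.sum_eq_single (kx x L)]
    · rw [Set.indicator_of_mem ((mem_dyadic_iff hx.1 _ _).2 rfl)]
      simp
    · intro k _ hk
      rw [Set.indicator_of_notMem (fun h => hk ((mem_dyadic_iff hx.1 _ _).1 h).symm)]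
      simp
    · intro h
      exact absurd (Finset.mem_range.2 (kx_lt hx L)) h
  rw [h1, Pmass_eq L y hx.1, Finset.prod_range, Fintype.prod_sigma]
  refine Finset.prod_congr rfl fun j _ => ?_
  have hh := kx_half hx.1 j
  have hlt := kx_lt hx j
  rw [Finset.prod_eq_single (⟨kx x j, hlt⟩ : Fin (2 ^ (j : ℕ)))]
  · have hc : kx x (j + 1) = 2 * kx x j ∨ kx x (j + 1) = 2 * kx x j + 1 := by omega
    rcases hc with hc | hc
    · rw [hc, Yt_even L y j (kx x j) j.2 hlt]
      simp
    · rw [hc, Yt_odd L y j (kx x j) j.2 hlt]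
      simp
  · intro k _ hk
    have hk' : kx x j ≠ k := fun h => hk (Fin.ext h.symm)
    have e1 : kx x (j + 1) ≠ 2 * (k : ℕ) := by omega
    have e2 : kx x (j + 1) ≠ 2 * (k : ℕ) + 1 := by omega
    simp [hk', e1, e2]
  · simp

lemma lik_eq {n : ℕ} (L : ℕ) (X : Fin n → ℝ) (hX : ∀ i, X i ∈ Set.Ioc (0 : ℝ) 1)
    (y : Node L → ℝ) :
    lik L X y = ∏ p : Node L, (2 ^ Ncnt X p.1 p.2 *
      (y p ^ Ncnt X ((p.1 : ℕ) + 1) (2 * (p.2 : ℕ)) *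
        (1 - y p) ^ Ncnt X ((p.1 : ℕ) + 1) (2 * (p.2 : ℕ) + 1))) := by
  unfold lik
  simp_rw [fun i => fY_eq L y (hX i)]
  rw [Finset.prod_comm]
  refine Finset.prod_congr rfl fun p _ => ?_
  rw [Finset.prod_mul_distrib, Finset.prod_mul_distrib, Finset.prod_pow_eq_pow_sum,
    Finset.prod_pow_eq_pow_sum, Finset.prod_pow_eq_pow_sum, Ncnt_eq X hX, Ncnt_eq X hX,
    Ncnt_eq X hX]

/-- Theorem 1, conjugacy of spike-and-slab Pólya trees: the normalizing
constant of the posterior is `∏_ε ((1-π_{ε0}) + π_{ε0} T(ε,X)) > 0`, and the posterior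
(the measure with density `ℓ_X/∫ℓ_X dQ` w.r.t. the prior `Q`) is the product measure
under which the `Y_{ε0}` are independent
`(1-π̃_{ε0})δ_{1/2} + π̃_{ε0} Beta(α_{ε0}(X), α_{ε1}(X))`. -/
theorem statement1 {n : ℕ} (L : ℕ) (hL : 1 ≤ L)
    (A : ℕ → ℕ → ℝ) (hA : ∀ l ≤ L, ∀ k < 2 ^ l, 0 < A l k)
    (πw : ℕ → ℕ → ℝ) (hπ : ∀ l < L, ∀ k < 2 ^ l, πw l k ∈ Set.Ioc (0 : ℝ) 1)
    (X : Fin n → ℝ) (hX : ∀ i, X i ∈ Set.Ioc (0 : ℝ) 1) :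
    (∫ y, lik L X y ∂ ssPriorGen L A πw) =
        (∏ p : Node L, ((1 - πw (p.1 : ℕ) (p.2 : ℕ)) +
          πw (p.1 : ℕ) (p.2 : ℕ) * TstatGen A X (p.1 : ℕ) (p.2 : ℕ))) ∧
    (0 : ℝ) < (∫ y, lik L X y ∂ ssPriorGen L A πw) ∧
    (ssPriorGen L A πw).withDensity
        (fun y => ENNReal.ofReal (lik L X y / ∫ y', lik L X y' ∂ ssPriorGen L A πw)) =
      Measure.pi (fun p : Node L =>
        mix (piTGen A πw X (p.1 : ℕ) (p.2 : ℕ))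
          (betaMeasure
            ((Ncnt X ((p.1 : ℕ) + 1) (2 * (p.2 : ℕ)) : ℝ) +
              A ((p.1 : ℕ) + 1) (2 * (p.2 : ℕ)))
            ((Ncnt X ((p.1 : ℕ) + 1) (2 * (p.2 : ℕ) + 1) : ℝ) +
              A ((p.1 : ℕ) + 1) (2 * (p.2 : ℕ) + 1)))) := by
  have hlt : ∀ p : Node L, (p.1 : ℕ) < L ∧ (p.2 : ℕ) < 2 ^ (p.1 : ℕ) := fun p => ⟨p.1.2, p.2.2⟩
  have ha : ∀ p : Node L, 0 < A ((p.1 : ℕ) + 1) (2 * (p.2 : ℕ)) := fun p =>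
    hA _ (hlt p).1 _ (by rw [pow_succ]; have := (hlt p).2; omega)
  have hb : ∀ p : Node L, 0 < A ((p.1 : ℕ) + 1) (2 * (p.2 : ℕ) + 1) := fun p =>
    hA _ (hlt p).1 _ (by rw [pow_succ]; have := (hlt p).2; omega)
  have hp : ∀ p : Node L, πw p.1 p.2 ∈ Set.Ioc (0 : ℝ) 1 := fun p => hπ _ (hlt p).1 _ (hlt p).2
  have hT : ∀ p : Node L, 0 < TstatGen A X p.1 p.2 := fun p => by
    have h1 := betaFn_pos (ha p) (hb p)
    have h2 := betaFn_pos (add_pos_of_nonneg_of_pos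
      (Nat.cast_nonneg (Ncnt X ((p.1 : ℕ) + 1) (2 * (p.2 : ℕ)))) (ha p))
      (add_pos_of_nonneg_of_pos
      (Nat.cast_nonneg (Ncnt X ((p.1 : ℕ) + 1) (2 * (p.2 : ℕ) + 1))) (hb p))
    unfold TstatGen
    positivity
  set Z : Node L → ℝ := fun p => (1 - πw (p.1 : ℕ) (p.2 : ℕ)) +
          πw (p.1 : ℕ) (p.2 : ℕ) * TstatGen A X (p.1 : ℕ) (p.2 : ℕ) with hZdef
  have hZ : ∀ p, 0 < Z p := fun p => by
    have := mul_pos (hp p).1 (hT p)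
    have := (hp p).2
    simp only [hZdef]
    linarith
  set μ : Node L → Measure ℝ := fun p => mix (πw (p.1 : ℕ) (p.2 : ℕ))
      (betaMeasure (A ((p.1 : ℕ) + 1) (2 * (p.2 : ℕ)))
        (A ((p.1 : ℕ) + 1) (2 * (p.2 : ℕ) + 1))) with hμ
  set ν : Node L → Measure ℝ := fun p : Node L =>
        mix (piTGen A πw X (p.1 : ℕ) (p.2 : ℕ))
          (betaMeasure
            ((Ncnt X ((p.1 : ℕ) + 1) (2 * (p.2 : ℕ)) : ℝ) +
              A ((p.1 : ℕ) + 1) (2 * (p.2 : ℕ)))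
            ((Ncnt X ((p.1 : ℕ) + 1) (2 * (p.2 : ℕ) + 1) : ℝ) +
              A ((p.1 : ℕ) + 1) (2 * (p.2 : ℕ) + 1))) with hν
  set g : Node L → ℝ → ℝ := fun p t => 2 ^ Ncnt X p.1 p.2 *
      (t ^ Ncnt X ((p.1 : ℕ) + 1) (2 * (p.2 : ℕ)) *
        (1 - t) ^ Ncnt X ((p.1 : ℕ) + 1) (2 * (p.2 : ℕ) + 1)) with hg
  have hlik : ∀ y, lik L X y = ∏ p, g p (y p) := lik_eq L X hX
  have hgm : ∀ p, Measurable (g p) := fun p => by simp only [hg]; fun_prop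
  have hg0 : ∀ p, ∀ t ∈ Set.Icc (0 : ℝ) 1, 0 ≤ g p t := fun p t ht => by
    have h1 : 0 ≤ t := ht.1
    have h2 : 0 ≤ 1 - t := by linarith [ht.2]
    simp only [hg]
    positivity
  have hμp : ∀ p, IsProbabilityMeasure (μ p) := fun p => by
    have := betaMeasure_prob (ha p) (hb p)
    exact mix_prob (hp p).1.le (hp p).2 _
  have hνp : ∀ p, IsProbabilityMeasure (ν p) := fun p => by
    have := betaMeasure_prob (add_pos_of_nonneg_of_pos
      (Nat.cast_nonneg (Ncnt X ((p.1 : ℕ) + 1) (2 * (p.2 : ℕ)))) (ha p))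
      (add_pos_of_nonneg_of_pos
      (Nat.cast_nonneg (Ncnt X ((p.1 : ℕ) + 1) (2 * (p.2 : ℕ) + 1))) (hb p))
    have h0 := mul_pos (hp p).1 (hT p)
    refine mix_prob ?_ ?_ _
    · exact div_nonneg h0.le (hZ p).le
    · refine (div_le_one (hZ p)).2 ?_
      linarith [(hp p).2]
  have hμae : ∀ p, ∀ᵐ t ∂(μ p), t ∈ Set.Icc (0 : ℝ) 1 := fun p => mix_ae
  have hwd : ∀ p, (μ p).withDensity (fun t => ENNReal.ofReal (g p t / Z p)) = ν p := fun p =>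
    mix_wd (ha p) (hb p) (hp p).1 (hp p).2 _ _ _ (Ncnt_add X hX _ _) rfl rfl
  have hint : ∀ p, ∫ t, g p t ∂(μ p) = Z p := fun p => by
    have h1 : ∫ t, g p t / Z p ∂(μ p) = 1 := by
      rw [integral_eq_lintegral_of_nonneg_ae]
      · rw [← setLIntegral_univ, ← withDensity_apply _ MeasurableSet.univ, hwd p]
        simp
      · filter_upwards [hμae p] with t ht
        exact div_nonneg (hg0 p t ht) (hZ p).le
      · exact ((hgm p).div_const _).aestronglyMeasurable
    rw [integral_div, div_eq_one_iff_eq (hZ p).ne'] at h1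
    exact h1
  have hI : (∫ y, lik L X y ∂ ssPriorGen L A πw) = ∏ p, Z p := by
    simp_rw [hlik]
    unfold ssPriorGen
    rw [integral_fintype_prod_eq_prod (𝕜 := ℝ) g]
    exact Finset.prod_congr rfl fun p _ => hint p
  refine ⟨hI, ?_, ?_⟩
  · rw [hI]
    exact Finset.prod_pos fun p _ => hZ p
  · rw [hI, ← pi_wd μ ν (fun p t => ENNReal.ofReal (g p t / Z p))
      (fun p => ((hgm p).div_const _).ennreal_ofReal) hwd]
    apply withDensity_congr_ae
    have hae : ∀ᵐ y ∂(Measure.pi μ), ∀ p, y p ∈ Set.Icc (0 : ℝ) 1 := by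
      rw [Filter.eventually_all]
      intro p
      exact (Measure.tendsto_eval_ae_ae (μ := μ) (i := p)).eventually (hμae p)
    filter_upwards [hae] with y hy
    rw [hlik, ← Finset.prod_div_distrib, ENNReal.ofReal_prod_of_nonneg]
    intro p _
    exact div_nonneg (hg0 p _ (hy p)) (hZ p).le

end SSPT

end
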